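/- arXiv:1801.03516 — 2 statements merged into one kernel-verified Lean document; each statement's English description precedes it below -/
import Mathlib

section
/- Let d ≥ 1, let A and B be symmetric positive definite d×d real matrices, let U be uniformly distributed on the unit sphere of ℝ^d, and let R be a nonnegative real random variable with finite second moment, independent of U. Let μ be the law of X = R·A·U and ν the law of R·B·U. Set M = B·(B·A²·B)^{-1/2}·B. Then M is symmetric positive definite, the law of M·X equals ν, and the law of the pair (X, M·X) is an optimal coupling of μ and ν. -/
open MeasureTheory ProbabilityTheory Matrix Finset
open scoped ENNReal

noncomputable section

/-- A coupling of `μ` and `ν`: a probability measure on the product with the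
prescribed marginals. -/
def IsCoupling {d : ℕ} (π : Measure ((Fin d → ℝ) × (Fin d → ℝ)))
    (μ ν : Measure (Fin d → ℝ)) : Prop :=
  IsProbabilityMeasure π ∧ π.map Prod.fst = μ ∧ π.map Prod.snd = ν

/-- Squared Euclidean distance on `ℝ^d`. -/
def sqDist {d : ℕ} (x y : Fin d → ℝ) : ℝ := ∑ i, (x i - y i) ^ 2

/-- The squared 2-Wasserstein distance: infimum of the quadratic transport cost
over all couplings. -/
def W2sq {d : ℕ} (μ ν : Measure (Fin d → ℝ)) : ℝ≥0∞ :=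
  ⨅ (π : Measure ((Fin d → ℝ) × (Fin d → ℝ))) (_ : IsCoupling π μ ν),
    ∫⁻ p, ENNReal.ofReal (sqDist p.1 p.2) ∂π

/-- Quantile (generalized inverse cdf) of a measure on `ℝ`. -/
def quantile (μ : Measure ℝ) (t : ℝ) : ℝ := sInf {s : ℝ | t ≤ cdf μ s}


/-- The uniform distribution on the unit sphere of `ℝ^d`, realized as a normalized
standard Gaussian vector. -/
def uniformSphere (d : ℕ) : Measure (Fin d → ℝ) :=
  (Measure.pi fun _ : Fin d => gaussianReal 0 1).map fun z =>
    (Real.sqrt (∑ i, z i ^ 2))⁻¹ • z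

/-- The Euclidean norm on `ℝ^d`. -/
def l2norm {d : ℕ} (x : Fin d → ℝ) : ℝ := Real.sqrt (∑ i, x i ^ 2)

/-- The quadratic function `x ↦ ‖x‖² - xᵀ N x`. -/
def potential {d : ℕ} (N : Matrix (Fin d) (Fin d) ℝ) (x : Fin d → ℝ) : ℝ :=
  x ⬝ᵥ x - x ⬝ᵥ N *ᵥ x

theorem measurable_mulVec {d : ℕ} (N : Matrix (Fin d) (Fin d) ℝ) :
    Measurable fun x : Fin d → ℝ => N *ᵥ x :=
  (Continuous.matrix_mulVec continuous_const continuous_id).measurable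

theorem measurable_sqDist {d : ℕ} :
    Measurable fun p : (Fin d → ℝ) × (Fin d → ℝ) => sqDist p.1 p.2 := by
  unfold sqDist
  fun_prop

theorem measurable_potential {d : ℕ} (N : Matrix (Fin d) (Fin d) ℝ) :
    Measurable (potential N) := by
  unfold potential dotProduct mulVec dotProduct
  fun_prop

theorem memLp_mulVec {α : Type*} [MeasurableSpace α] {ρ : Measure α} {d : ℕ}
    (N : Matrix (Fin d) (Fin d) ℝ) {f : α → Fin d → ℝ}
    (hf : ∀ i, MemLp (fun a => f a i) 2 ρ) (i : Fin d) :
    MemLp (fun a => (N *ᵥ f a) i) 2 ρ := by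
  simp only [mulVec, dotProduct]
  exact memLp_finsetSum _ fun j _ => (hf j).const_mul _

theorem integrable_dotProduct {α : Type*} [MeasurableSpace α] {ρ : Measure α} {d : ℕ}
    {f g : α → Fin d → ℝ} (hf : ∀ i, MemLp (fun a => f a i) 2 ρ)
    (hg : ∀ i, MemLp (fun a => g a i) 2 ρ) : Integrable (fun a => f a ⬝ᵥ g a) ρ := by
  simp only [dotProduct]
  exact integrable_finsetSum _ fun i _ => (hf i).integrable_mul (hg i)

theorem integrable_potential {d : ℕ}
    (N : Matrix (Fin d) (Fin d) ℝ) {ρ : Measure (Fin d → ℝ)}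
    (h : ∀ i, MemLp (fun x : Fin d → ℝ => x i) 2 ρ) : Integrable (potential N) ρ :=
  (integrable_dotProduct (f := id) (g := id) h h).sub
    (integrable_dotProduct (f := id) h (memLp_mulVec N h))

theorem sqDist_eq {d : ℕ} {M : Matrix (Fin d) (Fin d) ℝ} (hM : M.PosDef) (x y : Fin d → ℝ) :
    sqDist x y = potential M x + potential M⁻¹ y +
      (M *ᵥ x - y) ⬝ᵥ M⁻¹ *ᵥ (M *ᵥ x - y) := by
  have hdet : IsUnit M.det := (isUnit_iff_isUnit_det M).1 hM.isUnit
  have hMt : Mᵀ = M := by simpa using hM.isHermitian.eq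
  have h₁ : M⁻¹ *ᵥ (M *ᵥ x) = x := by rw [mulVec_mulVec, nonsing_inv_mul _ hdet, one_mulVec]
  have h₂ : (M *ᵥ x) ⬝ᵥ M⁻¹ *ᵥ y = x ⬝ᵥ y := by
    rw [← vecMul_transpose, hMt, ← dotProduct_mulVec, mulVec_mulVec, mul_nonsing_inv _ hdet,
      one_mulVec]
  have h₃ : sqDist x y = x ⬝ᵥ x + y ⬝ᵥ y - 2 * (x ⬝ᵥ y) := by
    simp only [sqDist, dotProduct, Finset.mul_sum, ← Finset.sum_add_distrib,
      ← Finset.sum_sub_distrib]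
    exact Finset.sum_congr rfl fun i _ => by ring
  rw [mulVec_sub, h₁, sub_dotProduct, dotProduct_sub, dotProduct_sub, h₂, h₃,
    dotProduct_comm (M *ᵥ x) x, dotProduct_comm y x, potential, potential]
  ring

theorem potential_add_le_sqDist {d : ℕ} {M : Matrix (Fin d) (Fin d) ℝ} (hM : M.PosDef)
    (x y : Fin d → ℝ) : potential M x + potential M⁻¹ y ≤ sqDist x y := by
  rw [sqDist_eq hM]
  have := hM.inv.posSemidef.dotProduct_mulVec_nonneg (M *ᵥ x - y)
  rw [star_trivial] at this
  linarith

theorem sqDist_mulVec {d : ℕ} {M : Matrix (Fin d) (Fin d) ℝ} (hM : M.PosDef) (x : Fin d → ℝ) :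
    sqDist x (M *ᵥ x) = potential M x + potential M⁻¹ (M *ᵥ x) := by
  rw [sqDist_eq hM]
  simp

theorem sqDist_nonneg {d : ℕ} (x y : Fin d → ℝ) : 0 ≤ sqDist x y :=
  Finset.sum_nonneg fun _ _ => sq_nonneg _

theorem ofReal_integral_le_lintegral_ofReal {α : Type*} [MeasurableSpace α] {ρ : Measure α}
    {f : α → ℝ} (hf : Integrable f ρ) :
    ENNReal.ofReal (∫ a, f a ∂ρ) ≤ ∫⁻ a, ENNReal.ofReal (f a) ∂ρ := by
  calc ENNReal.ofReal (∫ a, f a ∂ρ) ≤ ENNReal.ofReal (∫ a, max (f a) 0 ∂ρ) :=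
        ENNReal.ofReal_le_ofReal (integral_mono hf hf.pos_part fun a => le_max_left _ _)
    _ = ∫⁻ a, ENNReal.ofReal (max (f a) 0) ∂ρ :=
        ofReal_integral_eq_lintegral_ofReal hf.pos_part
          (Filter.Eventually.of_forall fun a => le_max_right _ _)
    _ = ∫⁻ a, ENNReal.ofReal (f a) ∂ρ := by simp [ENNReal.ofReal_max]

theorem IsCoupling.integrable_potential_add {d : ℕ} {μ ν : Measure (Fin d → ℝ)}
    {π : Measure ((Fin d → ℝ) × (Fin d → ℝ))} (hπ : IsCoupling π μ ν)
    {f g : (Fin d → ℝ) → ℝ} (hf : Integrable f μ) (hg : Integrable g ν) :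
    Integrable (fun p => f p.1 + g p.2) π ∧
      ∫ p, f p.1 + g p.2 ∂π = ∫ x, f x ∂μ + ∫ y, g y ∂ν := by
  obtain ⟨-, rfl, rfl⟩ := hπ
  have hf' := hf.comp_measurable measurable_fst
  have hg' := hg.comp_measurable measurable_snd
  refine ⟨hf'.add hg', ?_⟩
  rw [integral_map measurable_fst.aemeasurable hf.1, integral_map measurable_snd.aemeasurable hg.1]
  exact integral_add hf' hg'

/-- The graph of a positive definite linear map is optimal for the quadratic cost. -/
theorem lintegral_sqDist_graph_eq_W2sq {Ω : Type*} [MeasurableSpace Ω] {ρ : Measure Ω} {d : ℕ}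
    {M : Matrix (Fin d) (Fin d) ℝ} (hM : M.PosDef) {X : Ω → Fin d → ℝ} (hX : Measurable X)
    (hX2 : ∀ i, MemLp (fun ω => X ω i) 2 ρ) {μ ν : Measure (Fin d → ℝ)}
    (hc : IsCoupling (ρ.map fun ω => (X ω, M *ᵥ X ω)) μ ν) :
    ∫⁻ p, ENNReal.ofReal (sqDist p.1 p.2) ∂(ρ.map fun ω => (X ω, M *ᵥ X ω)) = W2sq μ ν := by
  have hMX : Measurable fun ω => M *ᵥ X ω := (measurable_mulVec M).comp hX
  have hgraph : Measurable fun ω => (X ω, M *ᵥ X ω) := hX.prodMk hMX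
  have hμ : μ = ρ.map X := by rw [← hc.2.1, Measure.map_map measurable_fst hgraph]; rfl
  have hν : ν = ρ.map fun ω => M *ᵥ X ω := by
    rw [← hc.2.2, Measure.map_map measurable_snd hgraph]; rfl
  have hf : Integrable (potential M) μ := integrable_potential M fun i => by
    rw [hμ, memLp_map_measure_iff (measurable_pi_apply i).aestronglyMeasurable hX.aemeasurable]
    exact hX2 i
  have hg : Integrable (potential M⁻¹) ν := integrable_potential M⁻¹ fun i => by
    rw [hν, memLp_map_measure_iff (measurable_pi_apply i).aestronglyMeasurable hMX.aemeasurable]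
    exact memLp_mulVec M hX2 i
  obtain ⟨h_int, hval⟩ := hc.integrable_potential_add hf hg
  have hgraph_cost : ∀ᵐ p ∂(ρ.map fun ω => (X ω, M *ᵥ X ω)),
      sqDist p.1 p.2 = potential M p.1 + potential M⁻¹ p.2 := by
    refine (ae_map_iff hgraph.aemeasurable (measurableSet_eq_fun measurable_sqDist
      (((measurable_potential M).comp measurable_fst).add
        ((measurable_potential M⁻¹).comp measurable_snd)))).2 ?_
    exact Filter.Eventually.of_forall fun ω => sqDist_mulVec hM (X ω)
  refine le_antisymm (le_iInf₂ fun π hπ => ?_) (iInf₂_le (ρ.map fun ω => (X ω, M *ᵥ X ω)) hc)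
  obtain ⟨h_int', hval'⟩ := hπ.integrable_potential_add hf hg
  calc ∫⁻ p, ENNReal.ofReal (sqDist p.1 p.2) ∂(ρ.map fun ω => (X ω, M *ᵥ X ω))
      = ∫⁻ p, ENNReal.ofReal (potential M p.1 + potential M⁻¹ p.2)
          ∂(ρ.map fun ω => (X ω, M *ᵥ X ω)) :=
        lintegral_congr_ae (hgraph_cost.mono fun _ hp => congrArg ENNReal.ofReal hp)
    _ = ENNReal.ofReal (∫ p, potential M p.1 + potential M⁻¹ p.2
          ∂(ρ.map fun ω => (X ω, M *ᵥ X ω))) :=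
        (ofReal_integral_eq_lintegral_ofReal h_int
          (hgraph_cost.mono fun p hp => (sqDist_nonneg p.1 p.2).trans_eq hp)).symm
    _ = ENNReal.ofReal (∫ p, potential M p.1 + potential M⁻¹ p.2 ∂π) := by rw [hval, hval']
    _ ≤ ∫⁻ p, ENNReal.ofReal (potential M p.1 + potential M⁻¹ p.2) ∂π :=
        ofReal_integral_le_lintegral_ofReal h_int'
    _ ≤ ∫⁻ p, ENNReal.ofReal (sqDist p.1 p.2) ∂π :=
        lintegral_mono fun p => ENNReal.ofReal_le_ofReal (potential_add_le_sqDist hM p.1 p.2)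

theorem sum_sq_mulVec_of_orthogonal {d : ℕ} {O : Matrix (Fin d) (Fin d) ℝ} (hO : Oᵀ * O = 1)
    (x : Fin d → ℝ) : ∑ i, (O *ᵥ x) i ^ 2 = ∑ i, x i ^ 2 := by
  have h : (O *ᵥ x) ⬝ᵥ (O *ᵥ x) = x ⬝ᵥ x := by
    rw [dotProduct_mulVec, ← mulVec_transpose, mulVec_mulVec, hO, one_mulVec]
  simpa only [dotProduct, ← sq] using h

/-- The standard Gaussian measure is invariant under orthogonal maps. -/
theorem map_mulVec_pi_gaussianReal {d : ℕ} {O : Matrix (Fin d) (Fin d) ℝ} (hO : Oᵀ * O = 1) :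
    (Measure.pi fun _ : Fin d => gaussianReal 0 1).map (fun z => O *ᵥ z) =
      Measure.pi fun _ : Fin d => gaussianReal 0 1 := by
  let L : EuclideanSpace ℝ (Fin d) →ₗᵢ[ℝ] EuclideanSpace ℝ (Fin d) :=
    { toLinearMap := toEuclideanLin O
      norm_map' := fun x => by
        rw [EuclideanSpace.norm_eq, EuclideanSpace.norm_eq]
        congr 1
        simp only [Real.norm_eq_abs, sq_abs]
        exact sum_sq_mulVec_of_orthogonal hO x.ofLp }
  let e := L.toLinearIsometryEquiv rfl
  have hcomp : (fun z => O *ᵥ z) =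
      WithLp.ofLp ∘ e ∘ (WithLp.toLp 2 : (Fin d → ℝ) → EuclideanSpace ℝ (Fin d)) := rfl
  rw [hcomp, ← Measure.map_map (by fun_prop) (by fun_prop),
    ← Measure.map_map (by fun_prop) (by fun_prop), map_pi_eq_stdGaussian, stdGaussian_map,
    ← map_pi_eq_stdGaussian, Measure.map_map (by fun_prop) (by fun_prop)]
  exact Measure.map_id

/-- The uniform distribution on the sphere is invariant under orthogonal maps. -/
theorem map_mulVec_uniformSphere {d : ℕ} {O : Matrix (Fin d) (Fin d) ℝ} (hO : Oᵀ * O = 1) :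
    (uniformSphere d).map (fun z => O *ᵥ z) = uniformSphere d := by
  have hn : Measurable fun z : Fin d → ℝ => (Real.sqrt (∑ i, z i ^ 2))⁻¹ • z := by fun_prop
  have hO' := measurable_mulVec O
  unfold uniformSphere
  conv_rhs => rw [← map_mulVec_pi_gaussianReal hO]
  rw [Measure.map_map hO' hn, Measure.map_map hn hO']
  congr 1
  ext1 z
  simp only [Function.comp_apply, sum_sq_mulVec_of_orthogonal hO, mulVec_smul]

theorem ae_abs_le_one_uniformSphere {d : ℕ} (i : Fin d) :
    ∀ᵐ u ∂(uniformSphere d), |u i| ≤ 1 := by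
  have hn : Measurable fun z : Fin d → ℝ => (Real.sqrt (∑ i, z i ^ 2))⁻¹ • z := by fun_prop
  unfold uniformSphere
  rw [ae_map_iff hn.aemeasurable (measurableSet_le (by fun_prop) measurable_const)]
  refine Filter.Eventually.of_forall fun z => ?_
  rw [Pi.smul_apply, smul_eq_mul, abs_mul, abs_inv, abs_of_nonneg (Real.sqrt_nonneg _)]
  refine inv_mul_le_one_of_le₀ (Real.abs_le_sqrt ?_) (Real.sqrt_nonneg _)
  exact Finset.single_le_sum (f := fun j => z j ^ 2) (fun _ _ => sq_nonneg _) (mem_univ i)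

/-- A radius independent of a uniform direction is jointly invariant under orthogonal maps. -/
theorem map_smul_mulVec_orthogonal {Ω : Type*} [MeasurableSpace Ω] {ρ : Measure Ω}
    [IsProbabilityMeasure ρ] {d : ℕ} {U : Ω → Fin d → ℝ} {R : Ω → ℝ} (hU : Measurable U)
    (hR : Measurable R) (hlaw : ρ.map U = uniformSphere d) (hRU : IndepFun R U ρ)
    (B : Matrix (Fin d) (Fin d) ℝ) {O : Matrix (Fin d) (Fin d) ℝ} (hO : Oᵀ * O = 1) :
    ρ.map (fun ω => R ω • (B *ᵥ O *ᵥ U ω)) = ρ.map (fun ω => R ω • (B *ᵥ U ω)) := by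
  have hO' := measurable_mulVec O
  have hOU : Measurable fun ω => O *ᵥ U ω := hO'.comp hU
  have hind : IndepFun R (fun ω => O *ᵥ U ω) ρ := hRU.comp measurable_id hO'
  have hOUlaw : ρ.map (fun ω => O *ᵥ U ω) = ρ.map U := by
    have h := Measure.map_map (μ := ρ) hO' hU
    rw [hlaw, map_mulVec_uniformSphere hO] at h
    rw [hlaw, h]
    rfl
  have hpair : ρ.map (fun ω => (R ω, O *ᵥ U ω)) = ρ.map (fun ω => (R ω, U ω)) := by
    rw [(indepFun_iff_map_prod_eq_prod_map_map hR.aemeasurable hOU.aemeasurable).1 hind,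
      (indepFun_iff_map_prod_eq_prod_map_map hR.aemeasurable hU.aemeasurable).1 hRU, hOUlaw]
  have hF : Measurable fun p : ℝ × (Fin d → ℝ) => p.1 • (B *ᵥ p.2) :=
    measurable_fst.smul ((measurable_mulVec B).comp measurable_snd)
  have h := congrArg (Measure.map fun p : ℝ × (Fin d → ℝ) => p.1 • (B *ᵥ p.2)) hpair
  rwa [Measure.map_map hF (hR.prodMk hOU), Measure.map_map hF (hR.prodMk hU)] at h

theorem optimal_transport_elliptical_related_class
    {d : ℕ} (hd : 1 ≤ d)
    {Ω : Type*} [MeasureSpace Ω] [IsProbabilityMeasure (ℙ : Measure Ω)]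
    (A B : Matrix (Fin d) (Fin d) ℝ) (hA : A.PosDef) (hB : B.PosDef)
    (U : Ω → Fin d → ℝ) (R : Ω → ℝ)
    (hUmeas : Measurable U) (hRmeas : Measurable R)
    (hUlaw : Measure.map U ℙ = uniformSphere d)
    (hRpos : ∀ ω, 0 ≤ R ω)
    (hR2 : Integrable (fun ω => R ω ^ 2) ℙ)
    (hRU : IndepFun R U ℙ)
    (X : Ω → Fin d → ℝ) (hX : X = fun ω => R ω • (A *ᵥ U ω))
    (μ ν : Measure (Fin d → ℝ))
    (hμ : μ = Measure.map X ℙ)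
    (hν : ν = Measure.map (fun ω => R ω • (B *ᵥ U ω)) ℙ)
    -- `C` is the unique symmetric positive semidefinite square root of `B * A² * B`
    (C : Matrix (Fin d) (Fin d) ℝ) (hC : C.PosSemidef) (hC2 : C * C = B * (A * A) * B)
    (M : Matrix (Fin d) (Fin d) ℝ) (hM : M = B * C⁻¹ * B) :
    M.PosDef ∧
    Measure.map (fun ω => M *ᵥ X ω) ℙ = ν ∧
    IsCoupling (Measure.map (fun ω => (X ω, M *ᵥ X ω)) ℙ) μ ν ∧
    (∫⁻ p, ENNReal.ofReal (sqDist p.1 p.2)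
        ∂(Measure.map (fun ω => (X ω, M *ᵥ X ω)) ℙ)) = W2sq μ ν := by
  have hAt : Aᵀ = A := by simpa using hA.isHermitian.eq
  have hBt : Bᵀ = B := by simpa using hB.isHermitian.eq
  have hCt : Cᵀ = C := by simpa using hC.isHermitian.eq
  have hCdet : C.det ≠ 0 := fun h0 => by
    have h := congrArg Matrix.det hC2
    simp only [det_mul, h0, mul_zero] at h
    have := hA.det_pos.ne'
    have := hB.det_pos.ne'
    simp_all
  have hCunit : IsUnit C.det := isUnit_iff_ne_zero.2 hCdet
  have hCpos : C.PosDef := hC.posDef_iff_det_ne_zero.2 hCdet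
  have hMpos : M.PosDef := by
    have h := hCpos.inv.conjTranspose_mul_mul_same (B := B)
      (mulVec_injective_iff_isUnit.2 hB.isUnit)
    rwa [hB.isHermitian.eq, ← hM] at h
  have hOO : (C⁻¹ * B * A)ᵀ * (C⁻¹ * B * A) = 1 := by
    rw [mul_eq_one_comm]
    simp only [transpose_mul, transpose_nonsing_inv, hAt, hBt, hCt]
    calc C⁻¹ * B * A * (A * (B * C⁻¹)) = C⁻¹ * (B * (A * A) * B) * C⁻¹ := by
          simp only [Matrix.mul_assoc]
      _ = 1 := by
          rw [← hC2, ← Matrix.mul_assoc, nonsing_inv_mul _ hCunit, Matrix.one_mul,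
            mul_nonsing_inv _ hCunit]
  have hXmeas : Measurable X := by
    rw [hX]
    exact hRmeas.smul ((measurable_mulVec A).comp hUmeas)
  have hMX : Measurable fun ω => M *ᵥ X ω := (measurable_mulVec M).comp hXmeas
  have hgraph : Measurable fun ω => (X ω, M *ᵥ X ω) := hXmeas.prodMk hMX
  have hlaw : Measure.map (fun ω => M *ᵥ X ω) ℙ = ν := by
    rw [hν, ← map_smul_mulVec_orthogonal hUmeas hRmeas hUlaw hRU B hOO]
    simp only [hX, hM, mulVec_smul, mulVec_mulVec, Matrix.mul_assoc]
  have hcoupling : IsCoupling (Measure.map (fun ω => (X ω, M *ᵥ X ω)) ℙ) μ ν := by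
    refine ⟨Measure.isProbabilityMeasure_map hgraph.aemeasurable, ?_, ?_⟩
    · rw [Measure.map_map measurable_fst hgraph, hμ]
      rfl
    · rw [Measure.map_map measurable_snd hgraph, ← hlaw]
      rfl
  have hR : MemLp R 2 ℙ := (memLp_two_iff_integrable_sq hRmeas.aestronglyMeasurable).2 hR2
  have hRU2 (i : Fin d) : MemLp (fun ω => (R ω • U ω) i) 2 ℙ := by
    refine hR.of_le (by fun_prop) ?_
    have h := ae_of_ae_map hUmeas.aemeasurable (hUlaw ▸ ae_abs_le_one_uniformSphere i)
    filter_upwards [h] with ω hω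
    rw [Pi.smul_apply, norm_smul]
    exact mul_le_of_le_one_right (norm_nonneg _) hω
  have hX2 (i : Fin d) : MemLp (fun ω => X ω i) 2 ℙ := by
    simpa only [hX, mulVec_smul] using memLp_mulVec A hRU2 i
  exact ⟨hMpos, hlaw, hcoupling, lintegral_sqDist_graph_eq_W2sq hMpos hXmeas hX2 hcoupling⟩
end
end

section
/- Let d ≥ 1, let A be a symmetric positive definite d×d real matrix, let U be uniformly distributed on the unit sphere of ℝ^d, and let S₁,…,Sₙ be strictly positive real random variables, each with continuous strictly increasing cumulative distribution function on (0,∞). Let λ₁,…,λₙ be positive reals summing to 1, let V be uniform on (0,1) independent of U, and set R† = Σⱼ λⱼ·F_{Sⱼ}^{-1}(V). Define, for j = 1,…,n, the map Tⱼ(x) = (F_{Sⱼ}^{-1}(F_{R†}(‖A^{-1}x‖₂))/‖A^{-1}x‖₂)·x for x ≠ 0. Then Σⱼ λⱼ·Tⱼ(X) = X almost surely, where X = R†·A·U; in particular, Σⱼ λⱼ·F_{Sⱼ}^{-1}(F_{R†}(r)) = r for almost every r with respect to the law of R†. -/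
open MeasureTheory ProbabilityTheory Matrix Finset
open scoped ENNReal

noncomputable section

/-- For a continuous distribution function, the quantile function is a right inverse on `(0, 1)`. -/
lemma cdf_quantile {μ : Measure ℝ} [IsProbabilityMeasure μ] (hc : Continuous (cdf μ)) {t : ℝ}
    (ht : t ∈ Set.Ioo (0 : ℝ) 1) : cdf μ (quantile μ t) = t := by
  have hne : {s : ℝ | t ≤ cdf μ s}.Nonempty :=
    (((tendsto_cdf_atTop μ).eventually (lt_mem_nhds ht.2)).exists).imp fun s hs => le_of_lt hs
  obtain ⟨a, ha⟩ := ((tendsto_cdf_atBot μ).eventually (gt_mem_nhds ht.1)).exists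
  have hlb : a ∈ lowerBounds {s : ℝ | t ≤ cdf μ s} := by
    intro s hs
    by_contra! h
    exact absurd (hs.trans (monotone_cdf μ h.le)) (not_le.2 ha)
  have hcl : IsClosed {s : ℝ | t ≤ cdf μ s} := isClosed_le continuous_const hc
  refine le_antisymm ?_ (hcl.csInf_mem hne ⟨a, hlb⟩)
  refine le_of_tendsto (f := cdf μ) (x := nhdsWithin (quantile μ t) (Set.Iio (quantile μ t)))
    (hc.continuousAt.tendsto.mono_left nhdsWithin_le_nhds) ?_
  filter_upwards [self_mem_nhdsWithin] with s hs
  by_contra! h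
  exact absurd (csInf_le ⟨a, hlb⟩ h.le) (not_le.2 hs)

lemma strictMonoOn_quantile {μ : Measure ℝ} [IsProbabilityMeasure μ] (hc : Continuous (cdf μ)) :
    StrictMonoOn (quantile μ) (Set.Ioo 0 1) := by
  intro s hs t ht hst
  by_contra! h
  have := monotone_cdf μ h
  rw [cdf_quantile hc hs, cdf_quantile hc ht] at this
  exact absurd this (not_le.2 hst)

lemma quantile_pos {μ : Measure ℝ} [IsProbabilityMeasure μ] (hc : Continuous (cdf μ))
    (h0 : μ (Set.Iic 0) = 0) {t : ℝ} (ht : t ∈ Set.Ioo (0 : ℝ) 1) : 0 < quantile μ t := by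
  by_contra! h
  have := monotone_cdf μ h
  rw [cdf_quantile hc ht, cdf_eq_real, measureReal_def, h0, ENNReal.toReal_zero] at this
  exact absurd this (not_le.2 ht.1)

/-- The distribution function of `g(V)`, with `V` uniform on `(0, 1)` and `g` strictly increasing,
is a left inverse of `g`. -/
lemma cdf_map_strictMonoOn {g : ℝ → ℝ} (hg : StrictMonoOn g (Set.Ioo 0 1)) {t : ℝ}
    (ht : t ∈ Set.Ioo (0 : ℝ) 1) :
    cdf ((volume.restrict (Set.Ioo (0 : ℝ) 1)).map g) (g t) = t := by
  have : IsProbabilityMeasure (volume.restrict (Set.Ioo (0 : ℝ) 1)) := ⟨by simp⟩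
  have hgm : AEMeasurable g (volume.restrict (Set.Ioo (0 : ℝ) 1)) :=
    aemeasurable_restrict_of_monotoneOn measurableSet_Ioo hg.monotoneOn
  have := Measure.isProbabilityMeasure_map hgm
  rw [cdf_eq_real, measureReal_def, Measure.map_apply_of_aemeasurable hgm measurableSet_Iic]
  have hset : g ⁻¹' Set.Iic (g t) =ᵐ[volume.restrict (Set.Ioo (0 : ℝ) 1)] Set.Iic t := by
    filter_upwards [ae_restrict_mem measurableSet_Ioo] with s hs
    exact propext (hg.le_iff_le hs ht)
  have hinter : Set.Iic t ∩ Set.Ioo 0 1 = Set.Ioc 0 t := by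
    ext s
    simp only [Set.mem_inter_iff, Set.mem_Iic, Set.mem_Ioo, Set.mem_Ioc]
    exact ⟨fun h => ⟨h.2.1, h.1⟩, fun h => ⟨h.2, h.1, h.2.trans_lt ht.2⟩⟩
  rw [measure_congr hset, Measure.restrict_apply measurableSet_Iic, hinter, Real.volume_Ioc,
    sub_zero, ENNReal.toReal_ofReal ht.1.le]

lemma l2norm_smul {d : ℕ} {c : ℝ} (hc : 0 ≤ c) (x : Fin d → ℝ) :
    l2norm (c • x) = c * l2norm x := by
  simp only [l2norm, Pi.smul_apply, smul_eq_mul, mul_pow, ← Finset.mul_sum]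
  rw [Real.sqrt_mul (sq_nonneg c), Real.sqrt_sq hc]

lemma l2norm_pos {d : ℕ} {x : Fin d → ℝ} (hx : x ≠ 0) : 0 < l2norm x := by
  obtain ⟨i, hi⟩ := Function.ne_iff.1 hx
  exact Real.sqrt_pos.2 (Finset.sum_pos' (fun i _ => sq_nonneg (x i))
    ⟨i, Finset.mem_univ i, sq_pos_of_ne_zero hi⟩)

lemma measurable_l2norm {d : ℕ} : Measurable (l2norm : (Fin d → ℝ) → ℝ) := by
  unfold l2norm
  fun_prop

lemma ae_l2norm_uniformSphere {d : ℕ} (hd : 1 ≤ d) : ∀ᵐ u ∂uniformSphere d, l2norm u = 1 := by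
  have := nullSingletonClass_gaussianReal (μ := 0) (v := 1) one_ne_zero
  have hmeas : Measurable fun z : Fin d → ℝ => (Real.sqrt (∑ i, z i ^ 2))⁻¹ • z := by
    fun_prop
  rw [uniformSphere, ae_map_iff hmeas.aemeasurable
    (measurableSet_eq_fun measurable_l2norm measurable_const)]
  have hz : ∀ᵐ z ∂(Measure.pi fun _ : Fin d => gaussianReal 0 1), z ≠ 0 := by
    have := Measure.pi_nullSingletonClass (μ := fun _ : Fin d => gaussianReal 0 1) ⟨0, hd⟩
    exact Measure.ae_ne _ 0
  filter_upwards [hz] with z hz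
  have hpos := l2norm_pos hz
  have := l2norm_smul (inv_nonneg.2 hpos.le) z
  rw [inv_mul_cancel₀ hpos.ne'] at this
  exact this

theorem barycenter_fixed_point_identity
    {d : ℕ} (hd : 1 ≤ d) {n : ℕ}
    {Ω : Type*} [MeasureSpace Ω] [IsProbabilityMeasure (ℙ : Measure Ω)]
    (A : Matrix (Fin d) (Fin d) ℝ) (hA : A.PosDef)
    (U : Ω → Fin d → ℝ) (hUmeas : Measurable U)
    (hUlaw : Measure.map U ℙ = uniformSphere d)
    (S : Fin n → Ω → ℝ)
    (hSmeas : ∀ j, Measurable (S j))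
    (hSpos : ∀ j ω, 0 < S j ω)
    (hFScont : ∀ j, Continuous fun t => cdf (Measure.map (S j) ℙ) t)
    (hFSmono : ∀ j, StrictMonoOn (fun t => cdf (Measure.map (S j) ℙ) t) (Set.Ioi 0))
    (w : Fin n → ℝ) (hw : ∀ j, 0 < w j) (hw1 : ∑ j, w j = 1)
    (V : Ω → ℝ) (hVmeas : Measurable V)
    (hVlaw : Measure.map V ℙ = volume.restrict (Set.Ioo (0 : ℝ) 1))
    (hVU : IndepFun V U ℙ)
    (Rdag : Ω → ℝ)
    (hRdag : Rdag = fun ω => ∑ j, w j * quantile (Measure.map (S j) ℙ) (V ω))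
    (T : Fin n → (Fin d → ℝ) → Fin d → ℝ)
    (hT : ∀ j x, x ≠ 0 → T j x =
      (quantile (Measure.map (S j) ℙ) (cdf (Measure.map Rdag ℙ) (l2norm (A⁻¹ *ᵥ x)))
        / l2norm (A⁻¹ *ᵥ x)) • x)
    (X : Ω → Fin d → ℝ) (hX : X = fun ω => Rdag ω • (A *ᵥ U ω)) :
    (∀ᵐ ω ∂ℙ, ∑ j, w j • T j (X ω) = X ω) ∧
    (∀ᵐ r ∂(Measure.map Rdag ℙ),
      ∑ j, w j * quantile (Measure.map (S j) ℙ) (cdf (Measure.map Rdag ℙ) r) = r) := by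
  have hprob : ∀ j, IsProbabilityMeasure (Measure.map (S j) ℙ) := fun j =>
    Measure.isProbabilityMeasure_map (hSmeas j).aemeasurable
  have hS0 : ∀ j, Measure.map (S j) ℙ (Set.Iic 0) = 0 := by
    intro j
    rw [Measure.map_apply (hSmeas j) measurableSet_Iic]
    convert measure_empty (μ := (ℙ : Measure Ω))
    ext ω
    simpa using hSpos j ω
  have hn : (Finset.univ : Finset (Fin n)).Nonempty := by
    by_contra h
    rw [Finset.not_nonempty_iff_eq_empty] at h
    simp [h] at hw1
  set g : ℝ → ℝ := fun t => ∑ j, w j * quantile (Measure.map (S j) ℙ) t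
  have hgmono : StrictMonoOn g (Set.Ioo 0 1) := fun s hs t ht hst =>
    Finset.sum_lt_sum_of_nonempty hn fun j _ =>
      mul_lt_mul_of_pos_left (strictMonoOn_quantile (hFScont j) hs ht hst) (hw j)
  have hgpos : ∀ t ∈ Set.Ioo (0 : ℝ) 1, 0 < g t := fun t ht =>
    Finset.sum_pos (fun j _ => mul_pos (hw j) (quantile_pos (hFScont j) (hS0 j) ht)) hn
  have hmono_meas : ∀ {f : ℝ → ℝ}, StrictMonoOn f (Set.Ioo 0 1) →
      AEMeasurable f (volume.restrict (Set.Ioo (0 : ℝ) 1)) := fun hf =>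
    aemeasurable_restrict_of_monotoneOn measurableSet_Ioo hf.monotoneOn
  have hgm := hmono_meas hgmono
  have hRlaw : Measure.map Rdag ℙ = (volume.restrict (Set.Ioo (0 : ℝ) 1)).map g := by
    rw [hRdag, ← hVlaw, AEMeasurable.map_map_of_aemeasurable (hVlaw ▸ hgm) hVmeas.aemeasurable]
    rfl
  have hcdf : ∀ t ∈ Set.Ioo (0 : ℝ) 1, cdf (Measure.map Rdag ℙ) (g t) = t := fun t ht => by
    rw [hRlaw, cdf_map_strictMonoOn hgmono ht]
  have hVmem : ∀ᵐ ω ∂ℙ, V ω ∈ Set.Ioo (0 : ℝ) 1 := by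
    apply ae_of_ae_map hVmeas.aemeasurable (p := (· ∈ Set.Ioo (0 : ℝ) 1))
    rw [hVlaw]
    exact ae_restrict_mem measurableSet_Ioo
  have hUnorm : ∀ᵐ ω ∂ℙ, l2norm (U ω) = 1 := by
    apply ae_of_ae_map hUmeas.aemeasurable (p := fun u => l2norm u = 1)
    rw [hUlaw]
    exact ae_l2norm_uniformSphere hd
  refine ⟨?_, ?_⟩
  · filter_upwards [hVmem, hUnorm] with ω hV hU
    have hR : Rdag ω = g (V ω) := by rw [hRdag]
    have hRpos : 0 < Rdag ω := hR ▸ hgpos _ hV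
    have hAX : A⁻¹ *ᵥ X ω = Rdag ω • U ω := by
      have hdet : IsUnit A.det := (Matrix.isUnit_iff_isUnit_det A).1 hA.isUnit
      simp only [hX, Matrix.mulVec_smul, Matrix.mulVec_mulVec, Matrix.nonsing_inv_mul A hdet,
        Matrix.one_mulVec]
    have hnorm : l2norm (A⁻¹ *ᵥ X ω) = Rdag ω := by
      rw [hAX, l2norm_smul hRpos.le, hU, mul_one]
    have hX0 : X ω ≠ 0 := by
      intro h
      rw [h, Matrix.mulVec_zero] at hnorm
      have h0 : l2norm (0 : Fin d → ℝ) = 0 := by simp [l2norm]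
      exact hRpos.ne (h0.symm.trans hnorm)
    have hT' : ∀ j, w j • T j (X ω) =
        (w j * quantile (Measure.map (S j) ℙ) (V ω) / Rdag ω) • X ω := fun j => by
      rw [hT j _ hX0, hnorm, smul_smul, mul_div_assoc, hR, hcdf _ hV]
    rw [Finset.sum_congr rfl fun j _ => hT' j, ← Finset.sum_smul, ← Finset.sum_div]
    change (g (V ω) / Rdag ω) • X ω = X ω
    rw [← hR, div_self hRpos.ne', one_smul]
  · rw [hRlaw] at hcdf ⊢
    set F := cdf ((volume.restrict (Set.Ioo (0 : ℝ) 1)).map g)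
    have hFm : Measurable F := (monotone_cdf _).measurable
    have hFlaw : ((volume.restrict (Set.Ioo (0 : ℝ) 1)).map g).map F =
        volume.restrict (Set.Ioo (0 : ℝ) 1) := by
      rw [AEMeasurable.map_map_of_aemeasurable hFm.aemeasurable hgm]
      conv_rhs => rw [← Measure.map_id (μ := volume.restrict (Set.Ioo (0 : ℝ) 1))]
      refine Measure.map_congr ?_
      filter_upwards [ae_restrict_mem measurableSet_Ioo] with t ht using hcdf t ht
    have hgF : AEMeasurable (g ∘ F) ((volume.restrict (Set.Ioo (0 : ℝ) 1)).map g) :=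
      AEMeasurable.comp_measurable (hFlaw.symm ▸ hgm) hFm
    change g ∘ F =ᵐ[_] id
    refine hgF.ae_eq_mk.trans ?_
    refine (ae_map_iff hgm (measurableSet_eq_fun hgF.measurable_mk measurable_id)).2 ?_
    filter_upwards [ae_restrict_mem measurableSet_Ioo, ae_of_ae_map hgm hgF.ae_eq_mk]
      with t ht hmk
    rw [← hmk, Function.comp_apply, hcdf t ht, id]
end
end
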